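/- arXiv:0808.1037 — 3 statements merged into one kernel-verified Lean document; each statement's English description precedes it below -/
import Mathlib

section
/- For the basis structure (δ_Z, ε_Z) on Fin 2 in FRel: a state φ : Rel Unit (Fin 2) is classical for (δ_Z, ε_Z) if and only if φ = z₀ or φ = z₁, and φ is unbiased for (δ_Z, ε_Z) if and only if φ = x₀. -/
namespace ToyQuantumCategories

/-- Relational composition in categorical order: `RelComp S R` is `S ∘ R`,
first apply `R : A → B`, then `S : B → C`. -/
def RelComp {A B C : Type*} (S : Rel B C) (R : Rel A B) : Rel A C :=
  fun a c => ∃ b, R a b ∧ S b c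

/-- The dagger (relational converse). -/
def RelDagger {A B : Type*} (R : Rel A B) : Rel B A :=
  fun b a => R a b

/-- The parallel (monoidal) product of two relations. -/
def RelProd {A₁ A₂ B₁ B₂ : Type*} (R₁ : Rel A₁ B₁) (R₂ : Rel A₂ B₂) :
    Rel (A₁ × A₂) (B₁ × B₂) :=
  fun p q => R₁ p.1 q.1 ∧ R₂ p.2 q.2

/-- The identity relation. -/
def RelId (A : Type*) : Rel A A := fun a b => a = b

/-- The graph of the exchange bijection `A × B ≃ B × A`. -/
def RelSwap (A B : Type*) : Rel (A × B) (B × A) := fun p q => q = (p.2, p.1)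

/-- The graph of a function. -/
def Graph {A B : Type*} (f : A → B) : Rel A B := fun a b => b = f a

/-- A basis structure (dagger special commutative Frobenius comonoid):
coassociative (up to the canonical reassociation bijection), cocommutative,
counital (up to the canonical bijection `Unit × A ≅ A`), isometric, and
satisfying the Frobenius identity `δ ∘ δ† = (δ† ⊗ id) ∘ (id ⊗ δ)`
(up to the canonical reassociation bijection). -/
structure IsBasisStructure {A : Type*} (δ : Rel A (A × A)) (ε : Rel A Unit) : Prop where
  coassoc : ∀ (a x y z : A),
    RelComp (RelProd δ (RelId A)) δ a ((x, y), z) ↔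
      RelComp (RelProd (RelId A) δ) δ a (x, (y, z))
  cocomm : RelComp (RelSwap A A) δ = δ
  counit : ∀ (a b : A), RelComp (RelProd ε (RelId A)) δ a ((), b) ↔ a = b
  isometry : RelComp (RelDagger δ) δ = RelId A
  frobenius : ∀ (a b c d : A),
    RelComp δ (RelDagger δ) (a, b) (c, d) ↔ ∃ y, δ b (y, d) ∧ δ c (a, y)

/-- A state `φ : I → A` is classical for `(δ, ε)` when `δ ∘ φ = φ ⊗ φ`
(up to the canonical bijection `Unit ≅ Unit × Unit`) and `ε ∘ φ` is the
identity relation on the tensor unit. -/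
def IsClassical {A : Type*} (δ : Rel A (A × A)) (ε : Rel A Unit) (φ : Rel Unit A) : Prop :=
  (∀ (a b : A), RelComp δ φ () (a, b) ↔ RelProd φ φ ((), ()) (a, b)) ∧
    RelComp ε φ = RelId Unit

/-- `Lam δ φ = δ† ∘ (φ ⊗ id_A)` (up to the canonical bijection `Unit × A ≅ A`):
it relates `a` to `b` iff there is `c` with `φ` relating `⋆` to `c` and `δ`
relating `b` to `(c, a)`. -/
def Lam {A : Type*} (δ : Rel A (A × A)) (φ : Rel Unit A) : Rel A A :=
  fun a b => ∃ c, φ () c ∧ δ b (c, a)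

/-- A state `φ : I → A` is unbiased for `δ` when `Lam δ φ` is unitary. -/
def IsUnbiased {A : Type*} (δ : Rel A (A × A)) (φ : Rel Unit A) : Prop :=
  RelComp (Lam δ φ) (RelDagger (Lam δ φ)) = RelId A ∧
    RelComp (RelDagger (Lam δ φ)) (Lam δ φ) = RelId A

/-- `δ_Z` on the two-element set: `i ∼ (i, i)` only. -/
def δZ : Rel (Fin 2) (Fin 2 × Fin 2) := fun i p => p = (i, i)

/-- `ε_Z` on the two-element set: the total relation to the unit. -/
def εZ : Rel (Fin 2) Unit := fun _ _ => True

/-- `δ_X` on the two-element set: `0 ∼ (0,0), (1,1)` and `1 ∼ (0,1), (1,0)`,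
i.e. `i ∼ (j, k)` iff `j + k = i` (mod 2). -/
def δX : Rel (Fin 2) (Fin 2 × Fin 2) := fun i p => p.1 + p.2 = i

/-- `ε_X` on the two-element set: `0 ∼ ⋆` only. -/
def εX : Rel (Fin 2) Unit := fun i _ => i = 0

/-- The state `z₀`: `⋆ ∼ 0` only. -/
def z₀ : Rel Unit (Fin 2) := fun _ j => j = 0

/-- The state `z₁`: `⋆ ∼ 1` only. -/
def z₁ : Rel Unit (Fin 2) := fun _ j => j = 1

/-- The state `x₀`: `⋆ ∼ 0` and `⋆ ∼ 1`. -/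
def x₀ : Rel Unit (Fin 2) := fun _ _ => True

/-- for `(δ_Z, ε_Z)` on `Fin 2`, the classical states are exactly
`z₀` and `z₁`, and the unbiased states are exactly `x₀`. -/
theorem classical_unbiased_for_Z :
    (∀ φ : Rel Unit (Fin 2), IsClassical δZ εZ φ ↔ (φ = z₀ ∨ φ = z₁)) ∧
    (∀ φ : Rel Unit (Fin 2), IsUnbiased δZ φ ↔ φ = x₀) := by
  have key : ∀ φ : Rel Unit (Fin 2), ∀ a b, Lam δZ φ a b ↔ a = b ∧ φ () a := by
    intro φ a b
    constructor
    · rintro ⟨c, hc, h⟩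
      have h1 : c = b := congrArg Prod.fst h
      have h2 : a = b := congrArg Prod.snd h
      subst h1; subst h2
      exact ⟨rfl, hc⟩
    · rintro ⟨rfl, h⟩
      exact ⟨a, h, rfl⟩
  have two : ∀ a : Fin 2, a = 0 ∨ a = 1 := by decide
  refine ⟨fun φ => ⟨?_, ?_⟩, fun φ => ⟨?_, ?_⟩⟩
  · rintro ⟨h1, h2⟩
    have uniq : ∀ a b, φ () a → φ () b → a = b := by
      intro a b ha hb
      obtain ⟨c, -, hc⟩ := (h1 a b).2 ⟨ha, hb⟩
      exact (congrArg Prod.fst hc).trans (congrArg Prod.snd hc).symm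
    have ex : RelComp εZ φ () () := by rw [h2]; rfl
    obtain ⟨b, hb, -⟩ := ex
    rcases two b with rfl | rfl
    · left
      funext u j
      exact propext ⟨fun h => uniq j 0 h hb, fun h => by cases (show j = 0 from h); exact hb⟩
    · right
      funext u j
      exact propext ⟨fun h => uniq j 1 h hb, fun h => by cases (show j = 1 from h); exact hb⟩
  · have aux : ∀ k : Fin 2, IsClassical δZ εZ (fun _ j => j = k) := by
      intro k
      refine ⟨fun a b => ⟨?_, ?_⟩, ?_⟩
      · rintro ⟨c, hc, h⟩
        exact ⟨(congrArg Prod.fst h).trans hc, (congrArg Prod.snd h).trans hc⟩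
      · rintro ⟨ha, hb⟩
        exact ⟨k, rfl, Prod.ext ha hb⟩
      · funext u v
        exact propext ⟨fun _ => rfl, fun _ => ⟨k, rfl, trivial⟩⟩
    rintro (rfl | rfl)
    · exact aux 0
    · exact aux 1
  · rintro ⟨h1, -⟩
    funext u j
    refine propext ⟨fun _ => trivial, fun _ => ?_⟩
    have h : RelComp (Lam δZ φ) (RelDagger (Lam δZ φ)) j j := by rw [h1]; rfl
    obtain ⟨b, -, hb⟩ := h
    obtain ⟨rfl, hphi⟩ := (key φ b j).1 hb
    exact hphi
  · rintro rfl
    constructor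
    · funext a b
      refine propext ⟨?_, ?_⟩
      · rintro ⟨c, hc, hb⟩
        exact ((key _ _ _).1 hc).1.symm.trans ((key _ _ _).1 hb).1
      · intro h
        cases (show a = b from h)
        exact ⟨a, (key _ _ _).2 ⟨rfl, trivial⟩, (key _ _ _).2 ⟨rfl, trivial⟩⟩
    · funext a b
      refine propext ⟨?_, ?_⟩
      · rintro ⟨c, hc, hb⟩
        exact ((key _ _ _).1 hc).1.trans ((key _ _ _).1 hb).1.symm
      · intro h
        cases (show a = b from h)
        exact ⟨a, (key _ _ _).2 ⟨rfl, trivial⟩, (key _ _ _).2 ⟨rfl, trivial⟩⟩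


end ToyQuantumCategories
end

section
/- For the basis structure (δ_X, ε_X) on Fin 2 in FRel: a state φ : Rel Unit (Fin 2) is classical for (δ_X, ε_X) if and only if φ = x₀, and φ is unbiased for (δ_X, ε_X) if and only if φ = z₀ or φ = z₁. -/
namespace ToyQuantumCategories

/-- for `(δ_X, ε_X)` on `Fin 2`, the classical states are exactly
`x₀`, and the unbiased states are exactly `z₀` and `z₁`. -/
theorem classical_unbiased_for_X :
    (∀ φ : Rel Unit (Fin 2), IsClassical δX εX φ ↔ φ = x₀) ∧
    (∀ φ : Rel Unit (Fin 2), IsUnbiased δX φ ↔ (φ = z₀ ∨ φ = z₁)) := by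
  have ext2 : ∀ φ ψ : Rel Unit (Fin 2), (φ () 0 ↔ ψ () 0) → (φ () 1 ↔ ψ () 1) → φ = ψ := by
    intro φ ψ h0 h1
    funext u j
    cases u
    fin_cases j
    · exact propext h0
    · exact propext h1
  constructor
  · intro φ
    constructor
    · rintro ⟨h, hε⟩
      have h1 := h 1 1
      have he : RelComp εX φ () () := by rw [hε]; rfl
      obtain ⟨b, hb, hb0⟩ := he
      have hb0' : b = 0 := hb0
      subst hb0'
      have hp : φ () 1 ∧ φ () 1 := h1.1 ⟨0, hb, rfl⟩
      exact ext2 _ _ ⟨fun _ => trivial, fun _ => hb⟩ ⟨fun _ => trivial, fun _ => hp.1⟩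
    · rintro rfl
      refine ⟨fun a b => ⟨fun _ => ⟨trivial, trivial⟩, fun _ => ⟨a + b, trivial, rfl⟩⟩, ?_⟩
      funext u v
      exact propext ⟨fun _ => rfl, fun _ => ⟨0, trivial, rfl⟩⟩
  · intro φ
    constructor
    · rintro ⟨h, -⟩
      have h00 : RelComp (Lam δX φ) (RelDagger (Lam δX φ)) 0 0 := by rw [h]; rfl
      have h01 : ¬ (φ () 0 ∧ φ () 1) := by
        rintro ⟨p0, p1⟩
        have hc : RelComp (Lam δX φ) (RelDagger (Lam δX φ)) 0 1 :=
          ⟨0, ⟨0, p0, rfl⟩, ⟨1, p1, rfl⟩⟩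
        rw [h] at hc
        exact absurd (show (0 : Fin 2) = 1 from hc) (by decide)
      obtain ⟨_, ⟨c, hc, -⟩, -⟩ := h00
      have hcc : c = 0 ∨ c = 1 := by omega
      rcases hcc with rfl | rfl
      · left
        exact ext2 _ _ ⟨fun _ => rfl, fun _ => hc⟩
          ⟨fun q => absurd ⟨hc, q⟩ h01, fun q => absurd (show (1 : Fin 2) = 0 from q) (by decide)⟩
      · right
        exact ext2 _ _
          ⟨fun q => absurd ⟨q, hc⟩ h01, fun q => absurd (show (0 : Fin 2) = 1 from q) (by decide)⟩
          ⟨fun _ => rfl, fun _ => hc⟩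
    · have key : ∀ k : Fin 2, IsUnbiased δX (fun _ j => j = k) := by
        intro k
        constructor
        · funext a b
          apply propext
          simp only [RelComp, RelDagger, Lam, δX, RelId]
          revert k a b
          decide
        · funext a b
          apply propext
          simp only [RelComp, RelDagger, Lam, δX, RelId]
          revert k a b
          decide
      rintro (rfl | rfl)
      · exact key 0
      · exact key 1

end ToyQuantumCategories
end

section
/- The basis structures (δ_Z, ε_Z) and (δ_X, ε_X) on Fin 2 in FRel are complementary: every state classical for (δ_X, ε_X) is unbiased for (δ_Z, ε_Z); every state classical for (δ_Z, ε_Z) is unbiased for (δ_X, ε_X); ε_X† is classical for (δ_Z, ε_Z); and ε_Z† is classical for (δ_X, ε_X). -/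
namespace ToyQuantumCategories

/-- the basis structures `(δ_Z, ε_Z)` and `(δ_X, ε_X)` on `Fin 2`
are complementary. -/
theorem Z_X_complementary :
    (∀ φ : Rel Unit (Fin 2), IsClassical δX εX φ → IsUnbiased δZ φ) ∧
    (∀ φ : Rel Unit (Fin 2), IsClassical δZ εZ φ → IsUnbiased δX φ) ∧
    IsClassical δZ εZ (RelDagger εX) ∧
    IsClassical δX εX (RelDagger εZ) := by
  refine ⟨?_, ?_, ?_, ?_⟩
  · rintro φ ⟨h, hε⟩
    have h0 : φ () 0 := by
      have h1 : RelComp εX φ () () := by rw [hε]; exact rfl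
      obtain ⟨b, hb, hb0⟩ := h1
      have hb0' : b = 0 := hb0
      exact hb0' ▸ hb
    have h1 : φ () 1 := ((h 1 1).1 ⟨0, h0, by simp [δX]⟩).1
    have hall : ∀ c, φ () c := by
      intro c
      fin_cases c
      · exact h0
      · exact h1
    have hL : Lam δZ φ = RelId (Fin 2) := by
      funext a b
      simp [Lam, δZ, RelId, hall]
    constructor <;> rw [hL] <;> funext a b <;> simp [RelComp, RelDagger, RelId, eq_comm]
  · rintro φ ⟨h, hε⟩
    have h1 : RelComp εZ φ () () := by rw [hε]; exact rfl
    obtain ⟨k, hk, -⟩ := h1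
    have huniq : ∀ c, φ () c ↔ c = k := by
      intro c
      constructor
      · intro hc
        obtain ⟨d, -, hd⟩ := (h c k).2 ⟨hc, hk⟩
        have hd' : (c, k) = (d, d) := hd
        rw [Prod.mk.injEq] at hd'
        rw [hd'.1, hd'.2]
      · rintro rfl
        exact hk
    have hL : Lam δX φ = fun a b => k + a = b := by
      funext a b
      simp [Lam, δX, huniq]
    constructor <;> rw [hL] <;> funext a b <;> apply propext <;>
      simp only [RelComp, RelDagger, RelId] <;> clear hL huniq hk h hε <;> revert k a b <;> decide
  · constructor
    · intro a b
      simp only [RelComp, RelProd, RelDagger, εX, δZ]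
      revert a b
      decide
    · funext a b
      simp [RelComp, RelDagger, RelId, εX, εZ]
  · constructor
    · intro a b
      simp [RelComp, RelProd, RelDagger, εZ, δX]
    · funext a b
      simp [RelComp, RelDagger, RelId, εX, εZ]

end ToyQuantumCategories
end
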